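/- Let w : ℝ² → ℝ be any function, let I ⊆ ℝ be an interval, and let x, y : I → ℝ be differentiable with x(t) > 0 for all t ∈ I, satisfying the Artstein control system x'(t) = 2 x(t) y(t) w(x(t), y(t)) and y'(t) = (y(t)² − x(t)²) w(x(t), y(t)) for all t ∈ I. Then the entropy function H is constant along the solution: for all s, t ∈ I, H(x(s), y(s)) = H(x(t), y(t)); equivalently, the solution remains on the circle x² + y² = 2cx with c = H(x(0), y(0)). -/

import Mathlib

/-- The entropy function `H(x,y) = (x² + y²)/(2x)`. -/
noncomputable def H (x y : ℝ) : ℝ := (x ^ 2 + y ^ 2) / (2 * x)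

/-- The entropy has zero derivative at every time where the control system holds and `x ≠ 0`. -/
theorem hasDerivAt_H_zero {x y : ℝ → ℝ} {t u : ℝ} (hxt : x t ≠ 0)
    (hx : HasDerivAt x (2 * x t * y t * u) t)
    (hy : HasDerivAt y ((y t ^ 2 - x t ^ 2) * u) t) :
    HasDerivAt (fun r => H (x r) (y r)) 0 t := by
  have h := ((hx.pow 2).add (hy.pow 2)).div (hx.const_mul 2) (mul_ne_zero two_ne_zero hxt)
  refine h.congr_deriv ?_
  rw [div_eq_zero_iff]
  left
  simp only [Pi.add_apply, Pi.pow_apply]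
  push_cast
  ring

/-- Along any positive solution of the Artstein control system
`x' = (2xy)w(x,y)`, `y' = (y² − x²)w(x,y)`, the entropy `H` is constant;
equivalently (when `0 ∈ I`) the solution remains on the circle
`x² + y² = 2cx` with `c = H(x(0), y(0))`. -/
theorem artstein_entropy_constant
    (w : ℝ → ℝ → ℝ) (I : Set ℝ) (hI : I.OrdConnected)
    (x y : ℝ → ℝ)
    (hxpos : ∀ t ∈ I, 0 < x t)
    (hx : ∀ t ∈ I, HasDerivAt x (2 * x t * y t * w (x t) (y t)) t)
    (hy : ∀ t ∈ I, HasDerivAt y ((y t ^ 2 - x t ^ 2) * w (x t) (y t)) t) :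
    (∀ s ∈ I, ∀ t ∈ I, H (x s) (y s) = H (x t) (y t)) ∧
    ((0 : ℝ) ∈ I → ∀ t ∈ I, x t ^ 2 + y t ^ 2 = 2 * H (x 0) (y 0) * x t) := by
  have hconst : ∀ s ∈ I, ∀ t ∈ I, H (x s) (y s) = H (x t) (y t) := by
    intro s hs t ht
    have h := hI.convex.norm_image_sub_le_of_norm_hasDerivWithin_le
      (f := fun r => H (x r) (y r)) (f' := fun _ => 0) (C := 0)
      (fun r hr =>
        (hasDerivAt_H_zero (hxpos r hr).ne' (hx r hr) (hy r hr)).hasDerivWithinAt)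
      (fun r _ => norm_zero.le) ht hs
    rw [zero_mul] at h
    exact sub_eq_zero.mp (norm_le_zero_iff.mp h)
  refine ⟨hconst, fun h0 t ht => ?_⟩
  have hxt := (hxpos t ht).ne'
  rw [hconst 0 h0 t ht, H]
  field_simp
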